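/- Let W be a regular multiplicative unitary on a complex Hilbert space H and set D := Â(W) ⊗min Â(Ŵ) ⊆ B(H ⊗ H), where Ŵ := ΣW*Σ. Then W is a multiplier of D: W·x ∈ D and x·W ∈ D for every x ∈ D. -/

import Mathlib

/-!
Common framework: we axiomatize realizations of Hilbert-space tensor products.
A `TensorPair E F EF` realizes the Hilbert tensor product `E ⊗ F` as the Hilbert
space `EF`: it consists of a bilinear map `(a, b) ↦ a ⊗ b` whose image satisfies
the characteristic inner-product identity and has total (dense) linear span.
Operators such as the leg operators `X₁₂`, `X₂₃`, `X₁₃`, amplifications `a ⊗ b`,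
and the tensor flip `Σ` are then uniquely characterized by their matrix
coefficients against elementary tensors.
-/

noncomputable section

open scoped InnerProductSpace
open ContinuousLinearMap

/-- A realization of the Hilbert tensor product `E ⊗ F` as the Hilbert space `EF`. -/
structure TensorPair (E F EF : Type*)
    [NormedAddCommGroup E] [InnerProductSpace ℂ E]
    [NormedAddCommGroup F] [InnerProductSpace ℂ F]
    [NormedAddCommGroup EF] [InnerProductSpace ℂ EF] where
  tmul : E →ₗ[ℂ] F →ₗ[ℂ] EF
  inner_tmul : ∀ (a c : E) (b d : F), ⟪tmul a b, tmul c d⟫_ℂ = ⟪a, c⟫_ℂ * ⟪b, d⟫_ℂ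
  dense_span : Dense (Submodule.span ℂ {z : EF | ∃ a b, z = tmul a b} : Set EF)

/-- A realization of the threefold Hilbert tensor product `E ⊗ F ⊗ G` as `EFG`. -/
structure TensorTriple (E F G EFG : Type*)
    [NormedAddCommGroup E] [InnerProductSpace ℂ E]
    [NormedAddCommGroup F] [InnerProductSpace ℂ F]
    [NormedAddCommGroup G] [InnerProductSpace ℂ G]
    [NormedAddCommGroup EFG] [InnerProductSpace ℂ EFG] where
  tmul : E →ₗ[ℂ] F →ₗ[ℂ] G →ₗ[ℂ] EFG
  inner_tmul : ∀ (a a' : E) (b b' : F) (c c' : G),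
    ⟪tmul a b c, tmul a' b' c'⟫_ℂ = ⟪a, a'⟫_ℂ * ⟪b, b'⟫_ℂ * ⟪c, c'⟫_ℂ
  dense_span : Dense (Submodule.span ℂ {z : EFG | ∃ a b c, z = tmul a b c} : Set EFG)

/-- The norm-closed linear span `[S]` of a set of vectors/operators. -/
def cspan {V : Type*} [NormedAddCommGroup V] [NormedSpace ℂ V] (S : Set V) : Set V :=
  closure (Submodule.span ℂ S : Set V)

/-- The set of right-leg slices `(id ⊗ ω_{ξ,η})(X)` of an operator
`X : M₁ ⊗ K₁ → M₂ ⊗ K₂`, i.e. all operators `T : M₁ → M₂` such that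
`⟪ζ, T ζ'⟫ = ⟪ζ ⊗ ξ, X (ζ' ⊗ η)⟫` for some `ξ ∈ K₂`, `η ∈ K₁`. -/
def slicesR {M₁ K₁ M₂ K₂ Ha Hb : Type*}
    [NormedAddCommGroup M₁] [InnerProductSpace ℂ M₁]
    [NormedAddCommGroup K₁] [InnerProductSpace ℂ K₁]
    [NormedAddCommGroup M₂] [InnerProductSpace ℂ M₂]
    [NormedAddCommGroup K₂] [InnerProductSpace ℂ K₂]
    [NormedAddCommGroup Ha] [InnerProductSpace ℂ Ha]
    [NormedAddCommGroup Hb] [InnerProductSpace ℂ Hb]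
    (ta : TensorPair M₁ K₁ Ha) (tb : TensorPair M₂ K₂ Hb)
    (X : Ha →L[ℂ] Hb) : Set (M₁ →L[ℂ] M₂) :=
  {T | ∃ (ξ : K₂) (η : K₁), ∀ (ζ : M₂) (ζ' : M₁),
    ⟪ζ, T ζ'⟫_ℂ = ⟪tb.tmul ζ ξ, X (ta.tmul ζ' η)⟫_ℂ}

/-- The set of left-leg slices `(ω_{ξ,η} ⊗ id)(X)` of an operator
`X : K₁ ⊗ M₁ → K₂ ⊗ M₂`, i.e. all operators `T : M₁ → M₂` such that
`⟪ζ, T ζ'⟫ = ⟪ξ ⊗ ζ, X (η ⊗ ζ')⟫` for some `ξ ∈ K₂`, `η ∈ K₁`. -/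
def slicesL {M₁ K₁ M₂ K₂ Ha Hb : Type*}
    [NormedAddCommGroup M₁] [InnerProductSpace ℂ M₁]
    [NormedAddCommGroup K₁] [InnerProductSpace ℂ K₁]
    [NormedAddCommGroup M₂] [InnerProductSpace ℂ M₂]
    [NormedAddCommGroup K₂] [InnerProductSpace ℂ K₂]
    [NormedAddCommGroup Ha] [InnerProductSpace ℂ Ha]
    [NormedAddCommGroup Hb] [InnerProductSpace ℂ Hb]
    (ta : TensorPair K₁ M₁ Ha) (tb : TensorPair K₂ M₂ Hb)
    (X : Ha →L[ℂ] Hb) : Set (M₁ →L[ℂ] M₂) :=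
  {T | ∃ (ξ : K₂) (η : K₁), ∀ (ζ : M₂) (ζ' : M₁),
    ⟪ζ, T ζ'⟫_ℂ = ⟪tb.tmul ξ ζ, X (ta.tmul η ζ')⟫_ℂ}

/-- `Â(X) := [(id ⊗ ω_{ξ,η})(X) : ξ, η ∈ H] ⊆ B(H)` for `X ∈ B(H ⊗ H)`. -/
def hatA {H H2 : Type*}
    [NormedAddCommGroup H] [InnerProductSpace ℂ H]
    [NormedAddCommGroup H2] [InnerProductSpace ℂ H2]
    (t2 : TensorPair H H H2) (X : H2 →L[ℂ] H2) : Set (H →L[ℂ] H) :=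
  cspan (slicesR t2 t2 X)

/-- `A(X) := [(ω_{ξ,η} ⊗ id)(X) : ξ, η ∈ H] ⊆ B(H)` for `X ∈ B(H ⊗ H)`. -/
def legA {H H2 : Type*}
    [NormedAddCommGroup H] [InnerProductSpace ℂ H]
    [NormedAddCommGroup H2] [InnerProductSpace ℂ H2]
    (t2 : TensorPair H H H2) (X : H2 →L[ℂ] H2) : Set (H →L[ℂ] H) :=
  cspan (slicesL t2 t2 X)

/-- `T` is the tensor-product operator `a ⊗ b : E ⊗ F → E' ⊗ F'`, characterized by its
matrix coefficients against elementary tensors.  In particular `IsTensorOp ta tb a 1 T`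
says that `T = a ⊗ 1`, and `IsTensorOp ta tb 1 b T` that `T = 1 ⊗ b`. -/
def IsTensorOp {E F EF E' F' EF' : Type*}
    [NormedAddCommGroup E] [InnerProductSpace ℂ E]
    [NormedAddCommGroup F] [InnerProductSpace ℂ F]
    [NormedAddCommGroup EF] [InnerProductSpace ℂ EF]
    [NormedAddCommGroup E'] [InnerProductSpace ℂ E']
    [NormedAddCommGroup F'] [InnerProductSpace ℂ F']
    [NormedAddCommGroup EF'] [InnerProductSpace ℂ EF']
    (ta : TensorPair E F EF) (tb : TensorPair E' F' EF')
    (a : E →L[ℂ] E') (b : F →L[ℂ] F') (T : EF →L[ℂ] EF') : Prop :=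
  ∀ (ζ : E') (ξ : F') (ζ' : E) (η : F),
    ⟪tb.tmul ζ ξ, T (ta.tmul ζ' η)⟫_ℂ = ⟪ζ, a ζ'⟫_ℂ * ⟪ξ, b η⟫_ℂ

/-- `A ⊗min B := [(a ⊗ 1)(1 ⊗ b) : a ∈ A, b ∈ B] = [a ⊗ b : a ∈ A, b ∈ B]`. -/
def minTensor {E F EF : Type*}
    [NormedAddCommGroup E] [InnerProductSpace ℂ E]
    [NormedAddCommGroup F] [InnerProductSpace ℂ F]
    [NormedAddCommGroup EF] [InnerProductSpace ℂ EF]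
    (t : TensorPair E F EF)
    (A : Set (E →L[ℂ] E)) (B : Set (F →L[ℂ] F)) : Set (EF →L[ℂ] EF) :=
  cspan {T | ∃ a ∈ A, ∃ b ∈ B, IsTensorOp t t a b T}

/-- `Y = X₁₂ = X ⊗ 1` on `E ⊗ F ⊗ G`, for `X ∈ B(E ⊗ F)`. -/
def IsLeg12 {E F G EF EFG : Type*}
    [NormedAddCommGroup E] [InnerProductSpace ℂ E]
    [NormedAddCommGroup F] [InnerProductSpace ℂ F]
    [NormedAddCommGroup G] [InnerProductSpace ℂ G]
    [NormedAddCommGroup EF] [InnerProductSpace ℂ EF]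
    [NormedAddCommGroup EFG] [InnerProductSpace ℂ EFG]
    (t2 : TensorPair E F EF) (t3 : TensorTriple E F G EFG)
    (X : EF →L[ℂ] EF) (Y : EFG →L[ℂ] EFG) : Prop :=
  ∀ (a a' : E) (b b' : F) (c c' : G),
    ⟪t3.tmul a b c, Y (t3.tmul a' b' c')⟫_ℂ
      = ⟪t2.tmul a b, X (t2.tmul a' b')⟫_ℂ * ⟪c, c'⟫_ℂ

/-- `Y = X₂₃ = 1 ⊗ X` on `E ⊗ F ⊗ G`, for `X ∈ B(F ⊗ G)`. -/
def IsLeg23 {E F G FG EFG : Type*}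
    [NormedAddCommGroup E] [InnerProductSpace ℂ E]
    [NormedAddCommGroup F] [InnerProductSpace ℂ F]
    [NormedAddCommGroup G] [InnerProductSpace ℂ G]
    [NormedAddCommGroup FG] [InnerProductSpace ℂ FG]
    [NormedAddCommGroup EFG] [InnerProductSpace ℂ EFG]
    (t2 : TensorPair F G FG) (t3 : TensorTriple E F G EFG)
    (X : FG →L[ℂ] FG) (Y : EFG →L[ℂ] EFG) : Prop :=
  ∀ (a a' : E) (b b' : F) (c c' : G),
    ⟪t3.tmul a b c, Y (t3.tmul a' b' c')⟫_ℂ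
      = ⟪t2.tmul b c, X (t2.tmul b' c')⟫_ℂ * ⟪a, a'⟫_ℂ

/-- `Y = X₁₃ = Σ₁₂X₂₃Σ₁₂` on `E ⊗ F ⊗ G`, for `X ∈ B(E ⊗ G)`: `X` acting on the
first and third legs. -/
def IsLeg13 {E F G EG EFG : Type*}
    [NormedAddCommGroup E] [InnerProductSpace ℂ E]
    [NormedAddCommGroup F] [InnerProductSpace ℂ F]
    [NormedAddCommGroup G] [InnerProductSpace ℂ G]
    [NormedAddCommGroup EG] [InnerProductSpace ℂ EG]
    [NormedAddCommGroup EFG] [InnerProductSpace ℂ EFG]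
    (t2 : TensorPair E G EG) (t3 : TensorTriple E F G EFG)
    (X : EG →L[ℂ] EG) (Y : EFG →L[ℂ] EFG) : Prop :=
  ∀ (a a' : E) (b b' : F) (c c' : G),
    ⟪t3.tmul a b c, Y (t3.tmul a' b' c')⟫_ℂ
      = ⟪t2.tmul a c, X (t2.tmul a' c')⟫_ℂ * ⟪b, b'⟫_ℂ

set_option linter.unusedSectionVars false

theorem inner_self_cx {E : Type*} [NormedAddCommGroup E] [InnerProductSpace ℂ E] (x : E) :
    ⟪x, x⟫_ℂ = ((‖x‖ : ℝ) : ℂ) ^ 2 := inner_self_eq_norm_sq_to_K x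

/-! ### Closed spans -/

theorem subset_cspan {V : Type*} [NormedAddCommGroup V] [NormedSpace ℂ V] {S : Set V} {x : V}
    (h : x ∈ S) : x ∈ cspan S := subset_closure (Submodule.subset_span h)

theorem cspan_map {V V' : Type*} [NormedAddCommGroup V] [NormedSpace ℂ V]
    [NormedAddCommGroup V'] [NormedSpace ℂ V'] {σ : ℂ →+* ℂ} (f : V →SL[σ] V')
    {S : Set V} {S' : Set V'} (h : ∀ x ∈ S, f x ∈ cspan S') :
    ∀ x ∈ cspan S, f x ∈ cspan S' := by
  intro x hx
  let N : Submodule ℂ V' := (Submodule.span ℂ S').topologicalClosure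
  have hN : ∀ y, y ∈ cspan S' ↔ y ∈ N := fun y => Iff.rfl
  have hc : IsClosed (f ⁻¹' (N : Set V')) :=
    (Submodule.isClosed_topologicalClosure _).preimage f.continuous
  have : cspan S ⊆ f ⁻¹' (N : Set V') := by
    refine closure_minimal ?_ hc
    intro y hy
    refine Submodule.span_induction (p := fun y _ => f y ∈ N) ?_ ?_ ?_ ?_ hy
    · intro x hx; exact h x hx
    · simp
    · intro x y _ _ hx hy; rw [map_add]; exact N.add_mem hx hy
    · intro c x _ hx; rw [map_smulₛₗ]; exact N.smul_mem _ hx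
  exact this hx

theorem cspan_le {V : Type*} [NormedAddCommGroup V] [NormedSpace ℂ V]
    {S S' : Set V} (h : ∀ x ∈ S, x ∈ cspan S') : ∀ x ∈ cspan S, x ∈ cspan S' :=
  cspan_map (ContinuousLinearMap.id ℂ V) h

theorem cspan_smul {V : Type*} [NormedAddCommGroup V] [NormedSpace ℂ V]
    {S : Set V} (c : ℂ) {x : V} (h : x ∈ cspan S) : c • x ∈ cspan S :=
  (Submodule.span ℂ S).topologicalClosure.smul_mem c h

/-! ### Basic constructions on tensor pairs -/

namespace TensorPair

section
variable {E F EF : Type*}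
    [NormedAddCommGroup E] [InnerProductSpace ℂ E]
    [NormedAddCommGroup F] [InnerProductSpace ℂ F]
    [NormedAddCommGroup EF] [InnerProductSpace ℂ EF]

theorem norm_tmul (t : TensorPair E F EF) (a : E) (b : F) : ‖t.tmul a b‖ = ‖a‖ * ‖b‖ := by
  have h := t.inner_tmul a a b b
  rw [inner_self_cx, inner_self_cx, inner_self_cx] at h
  have h2 : ‖t.tmul a b‖ ^ 2 = (‖a‖ * ‖b‖) ^ 2 := by
    rw [mul_pow]; exact_mod_cast h
  exact (pow_left_inj₀ (norm_nonneg _) (by positivity) two_ne_zero).1 h2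

/-- The tensor map as a continuous bilinear map; `L a b = a ⊗ b`. -/
def L (t : TensorPair E F EF) : E →L[ℂ] F →L[ℂ] EF :=
  t.tmul.mkContinuous₂ 1 (fun a b => by rw [norm_tmul, one_mul])

/-- `R b a = a ⊗ b`. -/
def R (t : TensorPair E F EF) : F →L[ℂ] E →L[ℂ] EF := t.L.flip

@[simp] theorem L_apply (t : TensorPair E F EF) (a : E) (b : F) : t.L a b = t.tmul a b := rfl
@[simp] theorem R_apply (t : TensorPair E F EF) (a : E) (b : F) : t.R b a = t.tmul a b := rfl

/-- The flipped pair. -/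
def swap (t : TensorPair E F EF) : TensorPair F E EF where
  tmul := t.tmul.flip
  inner_tmul a c b d := by simp [t.inner_tmul, mul_comm]
  dense_span := by
    convert t.dense_span using 4
    ext z
    constructor
    · rintro ⟨a, b, h⟩; exact ⟨b, a, h⟩
    · rintro ⟨a, b, h⟩; exact ⟨b, a, h⟩

@[simp] theorem swap_tmul (t : TensorPair E F EF) (a : E) (b : F) :
    t.swap.tmul b a = t.tmul a b := rfl

theorem clm_ext {G : Type*} [NormedAddCommGroup G] [NormedSpace ℂ G] {σ : ℂ →+* ℂ}
    (t : TensorPair E F EF)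
    {S T : EF →SL[σ] G} (h : ∀ a b, S (t.tmul a b) = T (t.tmul a b)) : S = T := by
  apply ContinuousLinearMap.ext_on t.dense_span
  rintro z ⟨a, b, rfl⟩
  exact h a b

theorem vec_ext (t : TensorPair E F EF) {x y : EF}
    (h : ∀ a b, ⟪t.tmul a b, x⟫_ℂ = ⟪t.tmul a b, y⟫_ℂ) : x = y := by
  have : (innerSLFlip ℂ x : EF →L⋆[ℂ] ℂ) = innerSLFlip ℂ y := t.clm_ext (by simpa using h)
  refine ext_inner_left ℂ (fun v => ?_)
  simpa using congrArg (fun f => f v) this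

theorem mem_cspan (t : TensorPair E F EF) (z : EF) :
    z ∈ cspan {z : EF | ∃ a b, z = t.tmul a b} := t.dense_span z

theorem denseRange (t : TensorPair E F EF) : DenseRange (TensorProduct.lift t.tmul) := by
  refine t.dense_span.mono ?_
  change _ ⊆ ((LinearMap.range (TensorProduct.lift t.tmul) : Submodule ℂ EF) : Set EF)
  rw [SetLike.coe_subset_coe, Submodule.span_le]
  rintro z ⟨a, b, rfl⟩
  exact ⟨a ⊗ₜ[ℂ] b, by simp⟩

end

section
variable {E F EF E' EF' : Type*}
    [NormedAddCommGroup E] [InnerProductSpace ℂ E] [CompleteSpace E]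
    [NormedAddCommGroup F] [InnerProductSpace ℂ F]
    [NormedAddCommGroup EF] [InnerProductSpace ℂ EF]
    [NormedAddCommGroup E'] [InnerProductSpace ℂ E'] [CompleteSpace E']
    [NormedAddCommGroup EF'] [InnerProductSpace ℂ EF'] [CompleteSpace EF']

theorem exists_defect (X : E →L[ℂ] E') : ∃ B : E →L[ℂ] E, ∀ x y,
    ⟪X x, X y⟫_ℂ + ⟪B x, B y⟫_ℂ = (‖X‖ : ℂ) ^ 2 * ⟪x, y⟫_ℂ := by
  have hpos : 0 ≤ (((‖X‖ : ℂ) ^ 2) • (1 : E →L[ℂ] E) - adjoint X ∘L X) := by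
    rw [ContinuousLinearMap.nonneg_iff_isPositive, ContinuousLinearMap.isPositive_iff_complex]
    intro x
    have h1 : ⟪((((‖X‖ : ℂ) ^ 2) • (1 : E →L[ℂ] E) - adjoint X ∘L X)) x, x⟫_ℂ
        = ((‖X‖ ^ 2 * ‖x‖ ^ 2 - ‖X x‖ ^ 2 : ℝ) : ℂ) := by
      simp only [sub_apply, smul_apply, inner_sub_left,
        inner_smul_left, one_apply_eq_self, ContinuousLinearMap.comp_apply,
        adjoint_inner_left, inner_self_cx]
      simp only [map_pow, Complex.conj_ofReal]
      push_cast
      ring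
    rw [h1]
    refine ⟨by rw [RCLike.re_to_complex, Complex.ofReal_re], ?_⟩
    have := X.le_opNorm x
    have h2 : ‖X x‖ ^ 2 ≤ (‖X‖ * ‖x‖) ^ 2 := by gcongr
    simp only [RCLike.re_to_complex, Complex.ofReal_re]
    nlinarith
  obtain ⟨B, hB⟩ := CStarAlgebra.nonneg_iff_eq_star_mul_self.1 hpos
  refine ⟨B, fun x y => ?_⟩
  have h := congrArg (fun T : E →L[ℂ] E => ⟪x, T y⟫_ℂ) hB
  simp only [sub_apply, smul_apply, inner_sub_right,
    inner_smul_right, one_apply_eq_self, ContinuousLinearMap.comp_apply,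
    adjoint_inner_right, ContinuousLinearMap.star_eq_adjoint, mul_apply_eq_comp] at h
  rw [← h]; ring

theorem exists_amp (ta : TensorPair E F EF) (tb : TensorPair E' F EF') (X : E →L[ℂ] E') :
    ∃ T : EF →L[ℂ] EF', (∀ a b, T (ta.tmul a b) = tb.tmul (X a) b) ∧ ‖T‖ ≤ ‖X‖ := by
  obtain ⟨B, hB⟩ := exists_defect X
  let U := TensorProduct.lift ta.tmul
  let V := TensorProduct.lift (tb.tmul ∘ₗ X.toLinearMap)
  let Z := TensorProduct.lift (ta.tmul ∘ₗ B.toLinearMap)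
  have key : ∀ z w, ⟪V z, V w⟫_ℂ + ⟪Z z, Z w⟫_ℂ = (‖X‖ : ℂ) ^ 2 * ⟪U z, U w⟫_ℂ := by
    intro z w
    induction z using TensorProduct.induction_on with
    | zero => simp
    | add x y hx hy =>
      simp only [map_add, inner_add_left, mul_add]; rw [← hx, ← hy]; ring
    | tmul a b =>
      induction w using TensorProduct.induction_on with
      | zero => simp
      | add x y hx hy =>
        simp only [map_add, inner_add_right, mul_add]; rw [← hx, ← hy]; ring
      | tmul c d =>
        simp only [U, V, Z, TensorProduct.lift.tmul, LinearMap.comp_apply, ContinuousLinearMap.coe_coe,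
          tb.inner_tmul, ta.inner_tmul]
        rw [← mul_assoc, ← hB]; ring
  have hn : ∀ z, ‖V z‖ ≤ ‖X‖ * ‖U z‖ := by
    intro z
    have h := key z z
    rw [inner_self_cx, inner_self_cx, inner_self_cx] at h
    have h2 : ‖V z‖ ^ 2 + ‖Z z‖ ^ 2 = ‖X‖ ^ 2 * ‖U z‖ ^ 2 := by exact_mod_cast h
    refine le_of_sq_le_sq ?_ (by positivity)
    nlinarith [sq_nonneg ‖Z z‖]
  refine ⟨V.extendOfNorm U, fun a b => ?_,
    LinearMap.opNorm_extendOfNorm_le ta.denseRange (norm_nonneg _) hn⟩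
  have := LinearMap.extendOfNorm_eq ta.denseRange ⟨_, hn⟩ (a ⊗ₜ[ℂ] b)
  simpa [U, V] using this

/-- The amplification `X ↦ X ⊗ 1`. -/
def ampL (ta : TensorPair E F EF) (tb : TensorPair E' F EF') :
    (E →L[ℂ] E') →L[ℂ] (EF →L[ℂ] EF') :=
  LinearMap.mkContinuous
    { toFun := fun X => (exists_amp ta tb X).choose
      map_add' := fun X Y => ta.clm_ext (fun a b => by
        rw [(exists_amp ta tb (X + Y)).choose_spec.1, add_apply, add_apply,
          (exists_amp ta tb X).choose_spec.1, (exists_amp ta tb Y).choose_spec.1]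
        simp)
      map_smul' := fun c X => ta.clm_ext (fun a b => by
        rw [(exists_amp ta tb (c • X)).choose_spec.1, smul_apply, smul_apply,
          (exists_amp ta tb X).choose_spec.1]
        simp) } 1
    (fun X => by rw [one_mul]; exact (exists_amp ta tb X).choose_spec.2)

@[simp] theorem ampL_apply (ta : TensorPair E F EF) (tb : TensorPair E' F EF') (X : E →L[ℂ] E')
    (a : E) (b : F) : ta.ampL tb X (ta.tmul a b) = tb.tmul (X a) b :=
  (exists_amp ta tb X).choose_spec.1 a b

end

section
variable {E F EF F' EF' : Type*}
    [NormedAddCommGroup E] [InnerProductSpace ℂ E]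
    [NormedAddCommGroup F] [InnerProductSpace ℂ F] [CompleteSpace F]
    [NormedAddCommGroup EF] [InnerProductSpace ℂ EF]
    [NormedAddCommGroup F'] [InnerProductSpace ℂ F'] [CompleteSpace F']
    [NormedAddCommGroup EF'] [InnerProductSpace ℂ EF'] [CompleteSpace EF']

/-- The amplification `X ↦ 1 ⊗ X`. -/
def ampR (ta : TensorPair E F EF) (tb : TensorPair E F' EF') :
    (F →L[ℂ] F') →L[ℂ] (EF →L[ℂ] EF') := ta.swap.ampL tb.swap

@[simp] theorem ampR_apply (ta : TensorPair E F EF) (tb : TensorPair E F' EF') (X : F →L[ℂ] F')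
    (a : E) (b : F) : ta.ampR tb X (ta.tmul a b) = tb.tmul a (X b) :=
  ampL_apply ta.swap tb.swap X b a

end

end TensorPair

/-! ### Splitting a triple into pairs -/

namespace TensorTriple

variable {E F G EF FG EFG : Type*}
    [NormedAddCommGroup E] [InnerProductSpace ℂ E]
    [NormedAddCommGroup F] [InnerProductSpace ℂ F]
    [NormedAddCommGroup G] [InnerProductSpace ℂ G]
    [NormedAddCommGroup EF] [InnerProductSpace ℂ EF]
    [NormedAddCommGroup FG] [InnerProductSpace ℂ FG]
    [NormedAddCommGroup EFG] [InnerProductSpace ℂ EFG] [CompleteSpace EFG]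

theorem exists_embed (t2 : TensorPair E F EF) (t3 : TensorTriple E F G EFG) (c : G) :
    ∃ T : EF →L[ℂ] EFG, ∀ a b, T (t2.tmul a b) = t3.tmul a b c := by
  let U := TensorProduct.lift t2.tmul
  let m : E →ₗ[ℂ] F →ₗ[ℂ] EFG := LinearMap.mk₂ ℂ (fun a b => t3.tmul a b c)
    (by simp) (by simp) (by simp) (by simp)
  let V := TensorProduct.lift m
  have key : ∀ z w, ⟪V z, V w⟫_ℂ = (‖c‖ : ℂ) ^ 2 * ⟪U z, U w⟫_ℂ := by
    intro z w
    induction z using TensorProduct.induction_on with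
    | zero => simp
    | add x y hx hy =>
      simp only [map_add, inner_add_left, mul_add]; rw [← hx, ← hy]
    | tmul a b =>
      induction w using TensorProduct.induction_on with
      | zero => simp
      | add x y hx hy =>
        simp only [map_add, inner_add_right, mul_add]; rw [← hx, ← hy]
      | tmul a' b' =>
        simp only [U, V, m, TensorProduct.lift.tmul, LinearMap.mk₂_apply, t2.inner_tmul,
          t3.inner_tmul, inner_self_cx]
        ring
  have hn : ∀ z, ‖V z‖ ≤ ‖c‖ * ‖U z‖ := by
    intro z
    have h := key z z
    rw [inner_self_cx, inner_self_cx] at h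
    have h2 : ‖V z‖ ^ 2 = ‖c‖ ^ 2 * ‖U z‖ ^ 2 := by exact_mod_cast h
    refine le_of_sq_le_sq ?_ (by positivity)
    nlinarith
  refine ⟨V.extendOfNorm U, fun a b => ?_⟩
  have := LinearMap.extendOfNorm_eq t2.denseRange ⟨_, hn⟩ (a ⊗ₜ[ℂ] b)
  simpa [U, V, m] using this

/-- The embedding `z ↦ z ⊗ c`. -/
def embed (t2 : TensorPair E F EF) (t3 : TensorTriple E F G EFG) (c : G) : EF →L[ℂ] EFG :=
  (exists_embed t2 t3 c).choose

@[simp] theorem embed_apply (t2 : TensorPair E F EF) (t3 : TensorTriple E F G EFG) (c : G)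
    (a : E) (b : F) : embed t2 t3 c (t2.tmul a b) = t3.tmul a b c :=
  (exists_embed t2 t3 c).choose_spec a b

theorem embed_inner (t2 : TensorPair E F EF) (t3 : TensorTriple E F G EFG) (c c' : G) (z z' : EF) :
    ⟪embed t2 t3 c z, embed t2 t3 c' z'⟫_ℂ = ⟪z, z'⟫_ℂ * ⟪c, c'⟫_ℂ := by
  have h1 : ∀ a b, (innerSL ℂ (embed t2 t3 c (t2.tmul a b))) ∘L embed t2 t3 c' =
      ⟪c, c'⟫_ℂ • innerSL ℂ (t2.tmul a b) := by
    intro a b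
    refine t2.clm_ext (fun a' b' => ?_)
    simp [t2.inner_tmul, t3.inner_tmul]; ring
  have h2 : (innerSLFlip ℂ (embed t2 t3 c' z')).comp (embed t2 t3 c) =
      ⟪c, c'⟫_ℂ • innerSLFlip ℂ z' := by
    refine t2.clm_ext (fun a b => ?_)
    have := congrArg (fun f => f z') (h1 a b)
    simpa using this
  have := congrArg (fun f => f z) h2
  simp only [ContinuousLinearMap.comp_apply, smul_apply,
    innerSLFlip_apply_apply, smul_eq_mul] at this
  rw [this]; ring

/-- The pair `(E ⊗ F) ⊗ G`. -/
def p12 (t2 : TensorPair E F EF) (t3 : TensorTriple E F G EFG) : TensorPair EF G EFG where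
  tmul := LinearMap.mk₂ ℂ (fun z c => embed t2 t3 c z) (by simp) (by simp)
    (fun z c c' => by
      have : embed t2 t3 (c + c') = embed t2 t3 c + embed t2 t3 c' :=
        t2.clm_ext (fun a b => by simp)
      simp [this])
    (fun k z c => by
      have : embed t2 t3 (k • c) = k • embed t2 t3 c :=
        t2.clm_ext (fun a b => by simp)
      simp [this])
  inner_tmul a c b d := by simp [embed_inner]
  dense_span := by
    refine t3.dense_span.mono (Submodule.span_mono ?_)
    rintro z ⟨a, b, c, rfl⟩
    exact ⟨t2.tmul a b, c, by simp⟩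

@[simp] theorem p12_tmul (t2 : TensorPair E F EF) (t3 : TensorTriple E F G EFG)
    (a : E) (b : F) (c : G) : (p12 t2 t3).tmul (t2.tmul a b) c = t3.tmul a b c := by
  simp [p12]

/-- The reversed triple. -/
def rev (t3 : TensorTriple E F G EFG) : TensorTriple G F E EFG where
  tmul := LinearMap.mk₂ ℂ (fun c b => (LinearMap.flip (t3.tmul.flip b)) c)
    (by intros; ext; simp) (by intros; ext; simp) (by intros; ext; simp) (by intros; ext; simp)
  inner_tmul a a' b b' c c' := by simp [t3.inner_tmul]; ring
  dense_span := by
    refine t3.dense_span.mono (Submodule.span_mono ?_)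
    rintro z ⟨a, b, c, rfl⟩
    exact ⟨c, b, a, by simp⟩

@[simp] theorem rev_tmul (t3 : TensorTriple E F G EFG) (a : E) (b : F) (c : G) :
    t3.rev.tmul c b a = t3.tmul a b c := by simp [rev]

/-- The pair `E ⊗ (F ⊗ G)`. -/
def p23 (t2 : TensorPair F G FG) (t3 : TensorTriple E F G EFG) : TensorPair E FG EFG :=
  (p12 t2.swap t3.rev).swap

@[simp] theorem p23_tmul (t2 : TensorPair F G FG) (t3 : TensorTriple E F G EFG)
    (a : E) (b : F) (c : G) : (p23 t2 t3).tmul a (t2.tmul b c) = t3.tmul a b c := by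
  have := p12_tmul t2.swap t3.rev c b a
  simpa [p23] using this

theorem clm_ext {K : Type*} [NormedAddCommGroup K] [NormedSpace ℂ K] {σ : ℂ →+* ℂ}
    (t : TensorTriple E F G EFG)
    {S T : EFG →SL[σ] K} (h : ∀ a b c, S (t.tmul a b c) = T (t.tmul a b c)) : S = T := by
  apply ContinuousLinearMap.ext_on t.dense_span
  rintro z ⟨a, b, c, rfl⟩
  exact h a b c

theorem vec_ext (t : TensorTriple E F G EFG) {x y : EFG}
    (h : ∀ a b c, ⟪t.tmul a b c, x⟫_ℂ = ⟪t.tmul a b c, y⟫_ℂ) : x = y := by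
  have : (innerSLFlip ℂ x : EFG →L⋆[ℂ] ℂ) = innerSLFlip ℂ y := t.clm_ext (by simpa using h)
  refine ext_inner_left ℂ (fun v => ?_)
  simpa using congrArg (fun f => f v) this

end TensorTriple

/-! ### Compact operators and rank one operators -/

section compact
variable {H : Type*} [NormedAddCommGroup H] [InnerProductSpace ℂ H] [CompleteSpace H]

theorem rankOne_compact (x y : H) : IsCompactOperator (InnerProductSpace.rankOne ℂ x y) := by
  rw [InnerProductSpace.rankOne_def']
  have h : IsCompactOperator (toSpanSingleton ℂ x) :=
    isCompactOperator_of_locallyCompactSpace_rng (toSpanSingleton ℂ x)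
  exact h.comp_clm (innerSL ℂ y)

theorem compact_mem_cspan (K : H →L[ℂ] H) (hK : IsCompactOperator K) :
    K ∈ cspan {T : H →L[ℂ] H | ∃ x y, T = InnerProductSpace.rankOne ℂ x y} := by
  rw [cspan, Metric.mem_closure_iff]
  intro ε hε
  have hc : IsCompact (closure (K '' Metric.closedBall 0 1)) :=
    IsCompactOperator.isCompact_closure_image_closedBall (f := (K : H →ₗ[ℂ] H)) hK 1
  obtain ⟨s, hs, hcov⟩ := Metric.totallyBounded_iff.1 hc.totallyBounded (ε / 2) (half_pos hε)
  let Y : Submodule ℂ H := Submodule.span ℂ s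
  have : FiniteDimensional ℂ Y := FiniteDimensional.span_of_finite ℂ hs
  refine ⟨Y.starProjection ∘L K, ?_, ?_⟩
  · rw [(stdOrthonormalBasis ℂ Y).starProjection_eq_sum_rankOne, SetLike.mem_coe]
    rw [ContinuousLinearMap.finsetSum_comp]
    refine Submodule.sum_mem _ (fun i _ => Submodule.subset_span ?_)
    exact ⟨_, _, InnerProductSpace.rankOne_comp _ _ _⟩
  · rw [dist_eq_norm]
    refine lt_of_le_of_lt ?_ (half_lt_self hε)
    refine ContinuousLinearMap.opNorm_le_of_unit_norm (half_pos hε).le (fun x hx => ?_)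
    have hx' : K x ∈ closure (K '' Metric.closedBall 0 1) :=
      subset_closure ⟨x, by simp [hx], rfl⟩
    obtain ⟨y, hy, hxy⟩ := Set.mem_iUnion₂.1 (hcov hx')
    rw [Metric.mem_ball, dist_eq_norm] at hxy
    have h1 := Submodule.starProjection_minimal (U := Y) (K x)
    have h2 : ‖K x - Y.starProjection (K x)‖ ≤ ‖K x - y‖ := by
      rw [h1]
      refine ciInf_le (f := fun w : Y => ‖K x - w‖) ⟨0, ?_⟩ ⟨y, Submodule.subset_span hy⟩
      rintro _ ⟨w, rfl⟩; exact norm_nonneg _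
    exact h2.trans hxy.le

end compact

/-! ### Slices and legs -/

section slices
variable {H H2 H3 : Type*}
    [NormedAddCommGroup H] [InnerProductSpace ℂ H] [CompleteSpace H]
    [NormedAddCommGroup H2] [InnerProductSpace ℂ H2] [CompleteSpace H2]
    [NormedAddCommGroup H3] [InnerProductSpace ℂ H3] [CompleteSpace H3]

/-- The slice `(id ⊗ ω_{ξ,η})(X)`. -/
def sl (t2 : TensorPair H H H2) (X : H2 →L[ℂ] H2) (ξ η : H) : H →L[ℂ] H :=
  adjoint (t2.R ξ) ∘L X ∘L t2.R η

theorem slicesR_eq (t2 : TensorPair H H H2) (X : H2 →L[ℂ] H2) :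
    slicesR t2 t2 X = {T | ∃ ξ η, T = sl t2 X ξ η} := by
  ext T
  constructor
  · rintro ⟨ξ, η, h⟩
    refine ⟨ξ, η, ?_⟩
    ext x
    refine ext_inner_left ℂ (fun v => ?_)
    rw [h]
    simp [sl, adjoint_inner_right]
  · rintro ⟨ξ, η, rfl⟩
    refine ⟨ξ, η, fun ζ ζ' => ?_⟩
    simp [sl, adjoint_inner_right]

theorem hatA_eq (t2 : TensorPair H H H2) (X : H2 →L[ℂ] H2) :
    hatA t2 X = cspan {T | ∃ ξ η, T = sl t2 X ξ η} := by
  rw [hatA, slicesR_eq]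

theorem sl_mem (t2 : TensorPair H H H2) (X : H2 →L[ℂ] H2) (ξ η : H) :
    sl t2 X ξ η ∈ hatA t2 X := by
  rw [hatA_eq]; exact subset_cspan ⟨ξ, η, rfl⟩

theorem adjoint_sl (t2 : TensorPair H H H2) (X : H2 →L[ℂ] H2) (ξ η : H) :
    adjoint (sl t2 X ξ η) = sl t2 (adjoint X) η ξ := by
  simp [sl, adjoint_comp, ContinuousLinearMap.comp_assoc]

theorem adjoint_R_apply (t2 : TensorPair H H H2) (ξ a b : H) :
    adjoint (t2.R ξ) (t2.tmul a b) = ⟪ξ, b⟫_ℂ • a := by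
  refine ext_inner_left ℂ (fun v => ?_)
  rw [adjoint_inner_right, t2.R_apply, t2.inner_tmul, inner_smul_right]; ring

theorem adjoint_L_apply (t2 : TensorPair H H H2) (ξ a b : H) :
    adjoint (t2.L ξ) (t2.tmul a b) = ⟪ξ, a⟫_ℂ • b := by
  refine ext_inner_left ℂ (fun v => ?_)
  rw [adjoint_inner_right, t2.L_apply, t2.inner_tmul, inner_smul_right]

theorem adjoint_R_comp_R (t2 : TensorPair H H H2) (ξ η : H) :
    adjoint (t2.R ξ) ∘L t2.R η = ⟪ξ, η⟫_ℂ • ContinuousLinearMap.id ℂ H := by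
  ext x; simp [adjoint_R_apply]

open TensorTriple

theorem leg12_eq (t2 : TensorPair H H H2) (t3 : TensorTriple H H H H3) {X : H2 →L[ℂ] H2}
    {Y : H3 →L[ℂ] H3} (h : IsLeg12 t2 t3 X Y) : Y = (p12 t2 t3).ampL (p12 t2 t3) X := by
  refine t3.clm_ext (fun a' b' c' => t3.vec_ext (fun a b c => ?_))
  rw [h, ← p12_tmul t2, ← p12_tmul t2, TensorPair.ampL_apply, TensorPair.inner_tmul]

theorem leg23_eq (t2 : TensorPair H H H2) (t3 : TensorTriple H H H H3) {X : H2 →L[ℂ] H2}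
    {Y : H3 →L[ℂ] H3} (h : IsLeg23 t2 t3 X Y) : Y = (p23 t2 t3).ampR (p23 t2 t3) X := by
  refine t3.clm_ext (fun a' b' c' => t3.vec_ext (fun a b c => ?_))
  rw [h, ← p23_tmul t2, ← p23_tmul t2, TensorPair.ampR_apply, TensorPair.inner_tmul, mul_comm]

/-- The embedding `a ⊗ c ↦ a ⊗ η ⊗ c`. -/
def Mid (t2 : TensorPair H H H2) (t3 : TensorTriple H H H H3) (η : H) : H2 →L[ℂ] H3 :=
  t2.ampR (p23 t2 t3) (t2.L η)

@[simp] theorem Mid_apply (t2 : TensorPair H H H2) (t3 : TensorTriple H H H H3) (η a c : H) :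
    Mid t2 t3 η (t2.tmul a c) = t3.tmul a η c := by simp [Mid]

theorem adjoint_Mid_apply (t2 : TensorPair H H H2) (t3 : TensorTriple H H H H3) (η a b c : H) :
    adjoint (Mid t2 t3 η) (t3.tmul a b c) = ⟪η, b⟫_ℂ • t2.tmul a c := by
  refine t2.vec_ext (fun a' c' => ?_)
  rw [adjoint_inner_right, Mid_apply, t3.inner_tmul, inner_smul_right, t2.inner_tmul]; ring

theorem adjoint_Mid_Mid (t2 : TensorPair H H H2) (t3 : TensorTriple H H H H3) (ξ η : H) :
    adjoint (Mid t2 t3 ξ) ∘L (Mid t2 t3 η) = ⟪ξ, η⟫_ℂ • ContinuousLinearMap.id ℂ H2 :=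
  t2.clm_ext (fun a c => by simp [adjoint_Mid_apply])

theorem adjoint_Mid_p12 (t2 : TensorPair H H H2) (t3 : TensorTriple H H H H3) (ξ η : H) (z : H2) :
    adjoint (Mid t2 t3 ξ) ((p12 t2 t3).tmul z η) = t2.tmul (adjoint (t2.R ξ) z) η := by
  have : adjoint (Mid t2 t3 ξ) ∘L (p12 t2 t3).R η = t2.R η ∘L adjoint (t2.R ξ) :=
    t2.clm_ext (fun a b => by simp [adjoint_Mid_apply, adjoint_R_apply])
  exact congrArg (fun f => f z) this

theorem adjoint_Mid_p23 (t2 : TensorPair H H H2) (t3 : TensorTriple H H H H3) (ξ a : H) (z : H2) :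
    adjoint (Mid t2 t3 ξ) ((p23 t2 t3).tmul a z) = t2.tmul a (adjoint (t2.L ξ) z) := by
  have : adjoint (Mid t2 t3 ξ) ∘L (p23 t2 t3).L a = t2.L a ∘L adjoint (t2.L ξ) :=
    t2.clm_ext (fun b c => by simp [adjoint_Mid_apply, adjoint_L_apply])
  exact congrArg (fun f => f z) this

theorem leg13_adjoint_Mid (t2 : TensorPair H H H2) (t3 : TensorTriple H H H H3) {X : H2 →L[ℂ] H2}
    {Y : H3 →L[ℂ] H3} (h : IsLeg13 t2 t3 X Y) (ξ : H) :
    adjoint (Mid t2 t3 ξ) ∘L Y = X ∘L adjoint (Mid t2 t3 ξ) := by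
  refine t3.clm_ext (fun a' b' c' => t2.vec_ext (fun a c => ?_))
  rw [ContinuousLinearMap.comp_apply, adjoint_inner_right, Mid_apply, h,
    ContinuousLinearMap.comp_apply, adjoint_Mid_apply, map_smul, inner_smul_right]
  ring

theorem leg13_Mid (t2 : TensorPair H H H2) (t3 : TensorTriple H H H H3) {X : H2 →L[ℂ] H2}
    {Y : H3 →L[ℂ] H3} (h : IsLeg13 t2 t3 X Y) (ξ : H) :
    Y ∘L Mid t2 t3 ξ = Mid t2 t3 ξ ∘L X := by
  refine t2.clm_ext (fun a' c' => t3.vec_ext (fun a b c => ?_))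
  rw [ContinuousLinearMap.comp_apply, Mid_apply, h, ContinuousLinearMap.comp_apply,
    ← adjoint_inner_left (Mid t2 t3 ξ), adjoint_Mid_apply, inner_smul_left, inner_conj_symm]
  ring

theorem ampL_comp_inv {E F EF : Type*}
    [NormedAddCommGroup E] [InnerProductSpace ℂ E] [CompleteSpace E]
    [NormedAddCommGroup F] [InnerProductSpace ℂ F]
    [NormedAddCommGroup EF] [InnerProductSpace ℂ EF] [CompleteSpace EF]
    (t : TensorPair E F EF) {X Y : E →L[ℂ] E} (h : X * Y = 1) :
    t.ampL t X * t.ampL t Y = 1 := by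
  refine t.clm_ext (fun a b => ?_)
  have : X (Y a) = a := congrArg (fun f : E →L[ℂ] E => f a) h
  simp [this]

theorem ampR_comp_inv {E F EF : Type*}
    [NormedAddCommGroup E] [InnerProductSpace ℂ E]
    [NormedAddCommGroup F] [InnerProductSpace ℂ F] [CompleteSpace F]
    [NormedAddCommGroup EF] [InnerProductSpace ℂ EF] [CompleteSpace EF]
    (t : TensorPair E F EF) {X Y : F →L[ℂ] F} (h : X * Y = 1) :
    t.ampR t X * t.ampR t Y = 1 := ampL_comp_inv t.swap h

theorem ampR_rankOne (t2 : TensorPair H H H2) (ν β : H) :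
    t2.ampR t2 (InnerProductSpace.rankOne ℂ ν β) = t2.R ν ∘L adjoint (t2.R β) :=
  t2.clm_ext (fun a b => by simp [adjoint_R_apply])

end slices

/-! ### The core argument -/

section core
variable {H H2 H3 : Type*}
    [NormedAddCommGroup H] [InnerProductSpace ℂ H] [CompleteSpace H]
    [NormedAddCommGroup H2] [InnerProductSpace ℂ H2] [CompleteSpace H2]
    [NormedAddCommGroup H3] [InnerProductSpace ℂ H3] [CompleteSpace H3]

open TensorTriple

/-- Left composition as a continuous linear map. -/
abbrev lcomp {E F G : Type*} [NormedAddCommGroup E] [NormedSpace ℂ E]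
    [NormedAddCommGroup F] [NormedSpace ℂ F] [NormedAddCommGroup G] [NormedSpace ℂ G]
    (T : F →L[ℂ] G) : (E →L[ℂ] F) →L[ℂ] (E →L[ℂ] G) := ContinuousLinearMap.compL ℂ E F G T

/-- Right composition as a continuous linear map. -/
abbrev rcomp {E F G : Type*} [NormedAddCommGroup E] [NormedSpace ℂ E]
    [NormedAddCommGroup F] [NormedSpace ℂ F] [NormedAddCommGroup G] [NormedSpace ℂ G]
    (T : E →L[ℂ] F) : (F →L[ℂ] G) →L[ℂ] (E →L[ℂ] G) := (ContinuousLinearMap.compL ℂ E F G).flip T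

theorem cspan_lcomp {E F G : Type*} [NormedAddCommGroup E] [NormedSpace ℂ E]
    [NormedAddCommGroup F] [NormedSpace ℂ F] [NormedAddCommGroup G] [NormedSpace ℂ G]
    (T : F →L[ℂ] G) {S : Set (E →L[ℂ] F)} {S' : Set (E →L[ℂ] G)}
    (h : ∀ x ∈ S, T ∘L x ∈ cspan S') : ∀ x ∈ cspan S, T ∘L x ∈ cspan S' :=
  cspan_map (lcomp T) h

theorem cspan_rcomp {E F G : Type*} [NormedAddCommGroup E] [NormedSpace ℂ E]
    [NormedAddCommGroup F] [NormedSpace ℂ F] [NormedAddCommGroup G] [NormedSpace ℂ G]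
    (T : E →L[ℂ] F) {S : Set (F →L[ℂ] G)} {S' : Set (E →L[ℂ] G)}
    (h : ∀ x ∈ S, x ∘L T ∈ cspan S') : ∀ x ∈ cspan S, x ∘L T ∈ cspan S' :=
  fun x hx => cspan_map (rcomp T) (S := S) (S' := S') (fun y hy => h y hy) x hx

/-- The space `[a ⊗ ν : a ∈ A, ν ∈ H]`. -/
def colSet (t2 : TensorPair H H H2) (A : Set (H →L[ℂ] H)) : Set (H →L[ℂ] H2) :=
  {T | ∃ ν, ∃ a ∈ A, T = t2.R ν ∘L a}

theorem core_KJ (t2 : TensorPair H H H2) (t3 : TensorTriple H H H H3) (Ws : H2 →L[ℂ] H2)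
    (ξ μ η : H) :
    adjoint (Mid t2 t3 ξ) ∘L (p12 t2 t3).ampL (p12 t2 t3) Ws ∘L (p23 t2 t3).R (t2.tmul μ η)
      = t2.R η ∘L sl t2 Ws ξ μ := by
  ext x
  simp only [ContinuousLinearMap.comp_apply, TensorPair.R_apply, p23_tmul, sl]
  rw [← p12_tmul t2, TensorPair.ampL_apply, adjoint_Mid_p12]

theorem core_R23 (t2 : TensorPair H H H2) (t3 : TensorTriple H H H H3) (W : H2 →L[ℂ] H2) (z : H2) :
    (p23 t2 t3).ampR (p23 t2 t3) W ∘L (p23 t2 t3).R z = (p23 t2 t3).R (W z) := by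
  ext x; simp

theorem core_k (t2 : TensorPair H H H2) (t3 : TensorTriple H H H H3) (W : H2 →L[ℂ] H2) (ξ η : H) :
    adjoint (Mid t2 t3 ξ) ∘L (p23 t2 t3).ampR (p23 t2 t3) W ∘L (p12 t2 t3).R η
      = t2.ampR t2 (adjoint (t2.L ξ) ∘L W ∘L t2.R η) := by
  refine t2.clm_ext (fun a b => ?_)
  simp only [ContinuousLinearMap.comp_apply, TensorPair.R_apply, p12_tmul, TensorPair.ampR_apply]
  rw [← p23_tmul t2, TensorPair.ampR_apply, adjoint_Mid_p23]

theorem core_KI (t2 : TensorPair H H H2) (t3 : TensorTriple H H H H3) (W Ws : H2 →L[ℂ] H2)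
    (h1 : Ws * W = 1) (h2 : W * Ws = 1)
    (W12 W23 W13 : H3 →L[ℂ] H3)
    (hW12 : IsLeg12 t2 t3 W W12) (hW23 : IsLeg23 t2 t3 W W23) (hW13 : IsLeg13 t2 t3 W W13)
    (hpent : W23 * W12 = W12 * W13 * W23) (ξ μ η : H) :
    adjoint (Mid t2 t3 ξ) ∘L (p12 t2 t3).ampL (p12 t2 t3) Ws ∘L
      (p23 t2 t3).ampR (p23 t2 t3) W ∘L (p23 t2 t3).R (t2.tmul μ η)
      = W ∘L t2.ampR t2 (adjoint (t2.L ξ) ∘L W ∘L t2.R η) ∘L Ws ∘L t2.R μ := by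
  have e12 := leg12_eq t2 t3 hW12
  have e23 := leg23_eq t2 t3 hW23
  rw [← e23]
  set V := (p12 t2 t3).ampL (p12 t2 t3) Ws with hV
  have i1 : V * W12 = 1 := by rw [hV, e12]; exact ampL_comp_inv _ h1
  have i2 : W12 * V = 1 := by rw [hV, e12]; exact ampL_comp_inv _ h2
  have hp : V * W23 = W13 * W23 * V := by
    calc V * W23 = V * (W23 * W12) * V := by rw [mul_assoc, mul_assoc, i2, mul_one]
      _ = (V * W12) * W13 * W23 * V := by rw [hpent]; simp only [mul_assoc]
      _ = _ := by rw [i1, one_mul]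
  have hJ : V ∘L (p23 t2 t3).R (t2.tmul μ η) = (p12 t2 t3).R η ∘L Ws ∘L t2.R μ := by
    ext x
    simp only [ContinuousLinearMap.comp_apply, TensorPair.R_apply, p23_tmul]
    rw [← p12_tmul t2, hV, TensorPair.ampL_apply]
  have := core_k t2 t3 W ξ η
  rw [← e23] at this
  rw [← this]
  calc _ = adjoint (Mid t2 t3 ξ) ∘L (V * W23) ∘L (p23 t2 t3).R (t2.tmul μ η) := rfl
    _ = (adjoint (Mid t2 t3 ξ) ∘L W13) ∘L W23 ∘L (V ∘L (p23 t2 t3).R (t2.tmul μ η)) := by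
      rw [hp]; rfl
    _ = _ := by rw [hJ, leg13_adjoint_Mid t2 t3 hW13]; rfl

/-- The adjoint as a continuous conjugate-linear map. -/
abbrev adjC (E F : Type*) [NormedAddCommGroup E] [InnerProductSpace ℂ E] [CompleteSpace E]
    [NormedAddCommGroup F] [InnerProductSpace ℂ F] [CompleteSpace F] :
    (E →L[ℂ] F) →SL[starRingEnd ℂ] (F →L[ℂ] E) :=
  (adjoint (𝕜 := ℂ) (E := E) (F := F)).toContinuousLinearEquiv.toContinuousLinearMap

theorem hatA_adjoint (t2 : TensorPair H H H2) :
    ∀ X : H2 →L[ℂ] H2, ∀ T ∈ hatA t2 X, adjoint T ∈ hatA t2 (adjoint X) := by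
  intro X
  rw [hatA_eq, hatA_eq]
  refine cspan_map (adjC H H) ?_
  rintro _ ⟨ζ, ν, rfl⟩
  change adjoint (sl t2 X ζ ν) ∈ _
  rw [adjoint_sl]
  exact subset_cspan ⟨_, _, rfl⟩

set_option maxHeartbeats 800000 in
theorem core (t2 : TensorPair H H H2) (t3 : TensorTriple H H H H3) (W : H2 →L[ℂ] H2)
    (h1 : adjoint W * W = 1) (h2 : W * adjoint W = 1)
    (W12 W23 W13 : H3 →L[ℂ] H3)
    (hW12 : IsLeg12 t2 t3 W W12) (hW23 : IsLeg23 t2 t3 W W23) (hW13 : IsLeg13 t2 t3 W W13)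
    (hpent : W23 * W12 = W12 * W13 * W23)
    (hr1 : ∀ ν β, InnerProductSpace.rankOne ℂ ν β ∈
      cspan {T | ∃ ξ η, T = adjoint (t2.L ξ) ∘L W ∘L t2.R η})
    (hr2 : ∀ ξ η, adjoint (t2.L ξ) ∘L W ∘L t2.R η ∈
      cspan {T : H →L[ℂ] H | ∃ ν β, T = InnerProductSpace.rankOne ℂ ν β}) :
    (∀ T ∈ cspan (colSet t2 (hatA t2 (adjoint W))),
      W ∘L T ∈ cspan (colSet t2 (hatA t2 (adjoint W)))) ∧
    (∀ T ∈ cspan (colSet t2 (hatA t2 (adjoint W))),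
      adjoint W ∘L T ∈ cspan (colSet t2 (hatA t2 (adjoint W)))) ∧
    hatA t2 W = hatA t2 (adjoint W) := by
  set Ws := adjoint W with hWs
  have hWa : adjoint Ws = W := by rw [hWs, adjoint_adjoint]
  have KI := core_KI t2 t3 W Ws h1 h2 W12 W23 W13 hW12 hW23 hW13 hpent
  have KJ := core_KJ t2 t3 Ws
  set P := p23 t2 t3
  set V := (p12 t2 t3).ampL (p12 t2 t3) Ws
  set C0 : Set (H →L[ℂ] H2) := {T | ∃ ν β μ, T = t2.R ν ∘L sl t2 Ws β μ} with hC0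
  set C1 : Set (H →L[ℂ] H2) := {T | ∃ ν β μ, T = W ∘L t2.R ν ∘L sl t2 Ws β μ} with hC1
  have hC : ∀ T ∈ cspan (colSet t2 (hatA t2 Ws)), T ∈ cspan C0 := by
    refine cspan_le ?_
    rintro _ ⟨ν, a, ha, rfl⟩
    rw [hatA_eq] at ha
    refine cspan_map (lcomp (t2.R ν)) (S := {T | ∃ ξ η, T = sl t2 Ws ξ η}) ?_ a ha
    rintro _ ⟨β, μ, rfl⟩
    exact subset_cspan ⟨ν, β, μ, rfl⟩
  have hC' : ∀ T ∈ cspan C0, T ∈ cspan (colSet t2 (hatA t2 Ws)) := by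
    refine cspan_le ?_
    rintro _ ⟨ν, β, μ, rfl⟩
    exact subset_cspan ⟨ν, _, sl_mem _ _ _ _, rfl⟩
  -- the two families `F ξ z`
  have F1 : ∀ ξ z, adjoint (Mid t2 t3 ξ) ∘L V ∘L P.R z ∈ cspan C0 := by
    intro ξ z
    refine cspan_map (lcomp (adjoint (Mid t2 t3 ξ) ∘L V) ∘L P.R) ?_ z (t2.mem_cspan z)
    rintro _ ⟨μ, η, rfl⟩
    change adjoint (Mid t2 t3 ξ) ∘L V ∘L P.R (t2.tmul μ η) ∈ _
    rw [KJ]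
    exact subset_cspan ⟨η, ξ, μ, rfl⟩
  have A1 : ∀ T ∈ cspan C0, W ∘L T ∈ cspan C0 := by
    refine cspan_map (lcomp W) ?_
    rintro _ ⟨ν, β, μ, rfl⟩
    have := cspan_map (lcomp W ∘L rcomp (Ws ∘L t2.R μ) ∘L t2.ampR t2) (S' := C0) ?_ _ (hr1 ν β)
    · simp only [ContinuousLinearMap.comp_apply, ampR_rankOne] at this
      exact this
    · rintro _ ⟨ξ, η, rfl⟩
      change W ∘L t2.ampR t2 (adjoint (t2.L ξ) ∘L W ∘L t2.R η) ∘L Ws ∘L t2.R μ ∈ _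
      rw [← KI, core_R23]
      exact F1 _ _
  have F2 : ∀ ξ z, adjoint (Mid t2 t3 ξ) ∘L V ∘L P.ampR P W ∘L P.R z ∈ cspan C1 := by
    intro ξ z
    refine cspan_map (lcomp (adjoint (Mid t2 t3 ξ) ∘L V ∘L P.ampR P W) ∘L P.R) ?_ z
      (t2.mem_cspan z)
    rintro _ ⟨μ, η, rfl⟩
    change adjoint (Mid t2 t3 ξ) ∘L V ∘L P.ampR P W ∘L P.R (t2.tmul μ η) ∈ _
    rw [KI]
    refine cspan_map (lcomp W ∘L rcomp (Ws ∘L t2.R μ) ∘L t2.ampR t2) (S' := C1) ?_ _ (hr2 ξ η)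
    rintro _ ⟨ν, β, rfl⟩
    simp only [ContinuousLinearMap.comp_apply, ampR_rankOne]
    exact subset_cspan ⟨ν, β, μ, rfl⟩
  have A2 : ∀ T ∈ cspan C0, T ∈ cspan C1 := by
    refine cspan_le ?_
    rintro _ ⟨η, ξ, μ, rfl⟩
    have := F2 ξ (Ws (t2.tmul μ η))
    rw [core_R23] at this
    have e : W (Ws (t2.tmul μ η)) = t2.tmul μ η :=
      congrArg (fun f : H2 →L[ℂ] H2 => f (t2.tmul μ η)) h2
    rw [e, KJ] at this
    exact this
  have A3 : ∀ T ∈ cspan C0, Ws ∘L T ∈ cspan C0 := by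
    intro T hT
    refine cspan_map (lcomp Ws) (S := C1) ?_ T (A2 T hT)
    rintro _ ⟨ν, β, μ, rfl⟩
    have e : (Ws ∘L (W ∘L t2.R ν ∘L sl t2 Ws β μ)) = t2.R ν ∘L sl t2 Ws β μ := by
      change (Ws * W) ∘L t2.R ν ∘L sl t2 Ws β μ = _
      rw [h1]; rfl
    change Ws ∘L (W ∘L t2.R ν ∘L sl t2 Ws β μ) ∈ _
    rw [e]
    exact subset_cspan ⟨ν, β, μ, rfl⟩
  refine ⟨fun T hT => hC' _ (A1 _ (hC _ hT)), fun T hT => hC' _ (A3 _ (hC _ hT)), ?_⟩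
  -- self-adjointness
  set N : Set (H →L[ℂ] H) := {T | ∃ ζ ν β μ, T = sl t2 W ζ ν ∘L sl t2 Ws β μ} with hN
  have N1 : ∀ T ∈ cspan N, T ∈ hatA t2 Ws := by
    rw [hatA_eq]
    refine cspan_le ?_
    rintro _ ⟨ζ, ν, β, μ, rfl⟩
    have e : sl t2 W ζ ν ∘L sl t2 Ws β μ
        = adjoint (t2.R ζ) ∘L (W ∘L (t2.R ν ∘L sl t2 Ws β μ)) := by
      ext x; simp only [sl, ContinuousLinearMap.comp_apply]
    rw [e]
    refine cspan_lcomp (adjoint (t2.R ζ)) ?_ _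
      (A1 (t2.R ν ∘L sl t2 Ws β μ) (subset_cspan ⟨ν, β, μ, rfl⟩))
    rintro _ ⟨ν', β', μ', rfl⟩
    rw [← ContinuousLinearMap.comp_assoc, adjoint_R_comp_R, ContinuousLinearMap.smul_comp, ContinuousLinearMap.id_comp]
    exact cspan_smul _ (subset_cspan ⟨_, _, rfl⟩)
  have N2 : ∀ T ∈ hatA t2 Ws, T ∈ cspan N := by
    rw [hatA_eq]
    refine cspan_le ?_
    rintro _ ⟨ξ, μ, rfl⟩
    by_cases hH : ∃ η : H, η ≠ 0
    · obtain ⟨η, hη⟩ := hH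
      have h := A2 (t2.R η ∘L sl t2 Ws ξ μ) (subset_cspan ⟨η, ξ, μ, rfl⟩)
      have h' := cspan_lcomp (adjoint (t2.R η)) (S' := N) ?_ _ h
      · rw [← ContinuousLinearMap.comp_assoc] at h'
        rw [adjoint_R_comp_R, ContinuousLinearMap.smul_comp, ContinuousLinearMap.id_comp] at h'
        have h'' := cspan_smul (⟪η, η⟫_ℂ)⁻¹ h'
        rwa [smul_smul, inv_mul_cancel₀ (inner_self_ne_zero.2 hη), one_smul] at h''
      · rintro _ ⟨ν, β, μ', rfl⟩
        refine subset_cspan ⟨η, ν, β, μ', ?_⟩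
        ext x; simp only [sl, ContinuousLinearMap.comp_apply]
    · push Not at hH
      have e : sl t2 Ws ξ μ = sl t2 W ξ ξ ∘L sl t2 Ws ξ ξ := by
        ext x; rw [hH (sl t2 Ws ξ μ x), hH ((sl t2 W ξ ξ ∘L sl t2 Ws ξ ξ) x)]
      rw [e]
      exact subset_cspan ⟨_, _, _, _, rfl⟩
  have N3 : ∀ T ∈ cspan N, adjoint T ∈ cspan N := by
    refine cspan_map (adjC H H) ?_
    rintro _ ⟨ζ, ν, β, μ, rfl⟩
    change adjoint (sl t2 W ζ ν ∘L sl t2 Ws β μ) ∈ _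
    rw [adjoint_comp, adjoint_sl, adjoint_sl, hWa]
    exact subset_cspan ⟨_, _, _, _, rfl⟩
  have adj := hatA_adjoint t2
  ext x
  constructor
  · intro hx
    have := N1 _ (N3 _ (N2 _ (adj W x hx)))
    rwa [adjoint_adjoint] at this
  · intro hx
    have := adj Ws _ (N1 _ (N3 _ (N2 _ hx)))
    rwa [hWa, adjoint_adjoint] at this

end core

/-! ### Conclusion -/

section final
variable {H H2 H3 : Type*}
    [NormedAddCommGroup H] [InnerProductSpace ℂ H] [CompleteSpace H]
    [NormedAddCommGroup H2] [InnerProductSpace ℂ H2] [CompleteSpace H2]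
    [NormedAddCommGroup H3] [InnerProductSpace ℂ H3] [CompleteSpace H3]

open TensorTriple

/-- The space of operators `ν ⊗ s`. -/
def colSetL (t2 : TensorPair H H H2) (B : Set (H →L[ℂ] H)) : Set (H →L[ℂ] H2) :=
  {T | ∃ ν, ∃ s ∈ B, T = t2.L ν ∘L s}

/-- The operators `a ⊗ η ⊗ s`. -/
def midSet (t2 : TensorPair H H H2) (t3 : TensorTriple H H H H3) (A B : Set (H →L[ℂ] H)) :
    Set (H2 →L[ℂ] H3) :=
  {T | ∃ η, ∃ a ∈ A, ∃ s ∈ B, T = Mid t2 t3 η ∘L t2.ampL t2 a ∘L t2.ampR t2 s}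

theorem mid12 (t2 : TensorPair H H H2) (t3 : TensorTriple H H H H3) (A B : Set (H →L[ℂ] H))
    (X : H2 →L[ℂ] H2) (hA : ∀ T ∈ cspan (colSet t2 A), X ∘L T ∈ cspan (colSet t2 A)) :
    ∀ T ∈ cspan (midSet t2 t3 A B),
      (p12 t2 t3).ampL (p12 t2 t3) X ∘L T ∈ cspan (midSet t2 t3 A B) := by
  refine cspan_lcomp _ ?_
  rintro _ ⟨η, a, ha, s, hs, rfl⟩
  have h := hA (t2.R η ∘L a) (subset_cspan ⟨η, a, ha, rfl⟩)
  have key := cspan_map (t2.ampL (p12 t2 t3)) (S := colSet t2 A)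
    (S' := {T | ∃ η, ∃ a ∈ A, T = Mid t2 t3 η ∘L t2.ampL t2 a}) ?_ _ h
  · have key2 := cspan_rcomp (t2.ampR t2 s) (S' := midSet t2 t3 A B) ?_ _ key
    · have e : (p12 t2 t3).ampL (p12 t2 t3) X ∘L Mid t2 t3 η ∘L t2.ampL t2 a ∘L t2.ampR t2 s
          = t2.ampL (p12 t2 t3) (X ∘L (t2.R η ∘L a)) ∘L t2.ampR t2 s := by
        refine t2.clm_ext (fun x y => ?_)
        simp only [ContinuousLinearMap.comp_apply, TensorPair.ampR_apply, TensorPair.ampL_apply,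
          Mid_apply, TensorPair.R_apply]
        rw [← p12_tmul t2, TensorPair.ampL_apply]
      rw [e]; exact key2
    · rintro _ ⟨η, a, ha, rfl⟩
      exact subset_cspan ⟨η, a, ha, s, hs, rfl⟩
  · rintro _ ⟨η, a, ha, rfl⟩
    refine subset_cspan ⟨η, a, ha, ?_⟩
    refine t2.clm_ext (fun x y => ?_)
    simp

theorem mid23 (t2 : TensorPair H H H2) (t3 : TensorTriple H H H H3) (A B : Set (H →L[ℂ] H))
    (X : H2 →L[ℂ] H2) (hB : ∀ T ∈ cspan (colSetL t2 B), X ∘L T ∈ cspan (colSetL t2 B)) :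
    ∀ T ∈ cspan (midSet t2 t3 A B),
      (p23 t2 t3).ampR (p23 t2 t3) X ∘L T ∈ cspan (midSet t2 t3 A B) := by
  refine cspan_lcomp _ ?_
  rintro _ ⟨η, a, ha, s, hs, rfl⟩
  have h := hB (t2.L η ∘L s) (subset_cspan ⟨η, s, hs, rfl⟩)
  have key := cspan_map (t2.ampR (p23 t2 t3)) (S := colSetL t2 B)
    (S' := {T | ∃ η, ∃ s ∈ B, T = Mid t2 t3 η ∘L t2.ampR t2 s}) ?_ _ h
  · have key2 := cspan_rcomp (t2.ampL t2 a) (S' := midSet t2 t3 A B) ?_ _ key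
    · have e : (p23 t2 t3).ampR (p23 t2 t3) X ∘L Mid t2 t3 η ∘L t2.ampL t2 a ∘L t2.ampR t2 s
          = t2.ampR (p23 t2 t3) (X ∘L (t2.L η ∘L s)) ∘L t2.ampL t2 a := by
        refine t2.clm_ext (fun x y => ?_)
        simp only [ContinuousLinearMap.comp_apply, TensorPair.ampR_apply, TensorPair.ampL_apply,
          Mid_apply, TensorPair.L_apply]
        rw [← p23_tmul t2, TensorPair.ampR_apply]
      rw [e]; exact key2
    · rintro _ ⟨η, s, hs, rfl⟩
      refine subset_cspan ⟨η, a, ha, s, hs, ?_⟩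
      refine t2.clm_ext (fun x y => ?_)
      simp
  · rintro _ ⟨η, s, hs, rfl⟩
    refine subset_cspan ⟨η, s, hs, ?_⟩
    refine t2.clm_ext (fun x y => ?_)
    simp

theorem colL_of_col (t2 : TensorPair H H H2) (B : Set (H →L[ℂ] H))
    (Sg : H2 →L[ℂ] H2) (hSg : ∀ a b : H, Sg (t2.tmul a b) = t2.tmul b a) (Y : H2 →L[ℂ] H2)
    (hY : ∀ T ∈ cspan (colSet t2 B), Y ∘L T ∈ cspan (colSet t2 B)) :
    ∀ T ∈ cspan (colSetL t2 B), (Sg * Y * Sg) ∘L T ∈ cspan (colSetL t2 B) := by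
  refine cspan_lcomp _ ?_
  rintro _ ⟨ν, s, hs, rfl⟩
  have h := hY (t2.R ν ∘L s) (subset_cspan ⟨ν, s, hs, rfl⟩)
  have key := cspan_lcomp Sg (S' := colSetL t2 B) ?_ _ h
  · have e : (Sg * Y * Sg) ∘L (t2.L ν ∘L s) = Sg ∘L (Y ∘L (t2.R ν ∘L s)) := by
      ext x
      simp [hSg]
    rw [e]; exact key
  · rintro _ ⟨ν, s, hs, rfl⟩
    refine subset_cspan ⟨ν, s, hs, ?_⟩
    ext x
    simp [hSg]

theorem tensorOp_iff (t2 : TensorPair H H H2) (a b : H →L[ℂ] H) (T : H2 →L[ℂ] H2) :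
    IsTensorOp t2 t2 a b T ↔ T = t2.ampL t2 a ∘L t2.ampR t2 b := by
  constructor
  · intro h
    refine t2.clm_ext (fun x y => t2.vec_ext (fun x' y' => ?_))
    rw [h]
    simp [t2.inner_tmul]
  · rintro rfl ζ ξ ζ' η
    simp [t2.inner_tmul]

theorem minTensor_eq (t2 : TensorPair H H H2) (A B : Set (H →L[ℂ] H)) :
    minTensor t2 A B = cspan {T | ∃ a ∈ A, ∃ b ∈ B, T = t2.ampL t2 a ∘L t2.ampR t2 b} := by
  simp only [minTensor, tensorOp_iff]

theorem minTensor_adjoint (t2 : TensorPair H H H2) (A B : Set (H →L[ℂ] H))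
    (hA : ∀ a ∈ A, adjoint a ∈ A) (hB : ∀ b ∈ B, adjoint b ∈ B) :
    ∀ x ∈ minTensor t2 A B, adjoint x ∈ minTensor t2 A B := by
  refine cspan_map (adjC H2 H2) ?_
  rintro T ⟨a, ha, b, hb, h⟩
  refine subset_cspan ⟨_, hA a ha, _, hB b hb, ?_⟩
  intro ζ ξ ζ' η
  change ⟪_, adjoint T _⟫_ℂ = _
  rw [adjoint_inner_right, adjoint_inner_right, adjoint_inner_right, ← inner_conj_symm, h,
    map_mul, inner_conj_symm, inner_conj_symm]

/-- If `Y` intertwines the `Mid` maps with `X` and preserves the middle space, then `X`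
multiplies the minimal tensor product. -/
theorem mult_of_mid (t2 : TensorPair H H H2) (t3 : TensorTriple H H H H3) (A B : Set (H →L[ℂ] H))
    (X : H2 →L[ℂ] H2) (Y : H3 →L[ℂ] H3) (hXY : ∀ η, Y ∘L Mid t2 t3 η = Mid t2 t3 η ∘L X)
    (hY : ∀ T ∈ cspan (midSet t2 t3 A B), Y ∘L T ∈ cspan (midSet t2 t3 A B)) :
    ∀ x ∈ minTensor t2 A B, X ∘L x ∈ minTensor t2 A B := by
  rw [minTensor_eq]
  refine cspan_lcomp X ?_
  rintro _ ⟨a, ha, b, hb, rfl⟩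
  by_cases hH : ∃ η : H, η ≠ 0
  · obtain ⟨η, hη⟩ := hH
    have h := hY (Mid t2 t3 η ∘L t2.ampL t2 a ∘L t2.ampR t2 b)
      (subset_cspan ⟨η, a, ha, b, hb, rfl⟩)
    have h' := cspan_lcomp (adjoint (Mid t2 t3 η))
      (S' := {T | ∃ a ∈ A, ∃ b ∈ B, T = t2.ampL t2 a ∘L t2.ampR t2 b}) ?_ _ h
    · rw [← ContinuousLinearMap.comp_assoc Y, hXY, ContinuousLinearMap.comp_assoc (Mid t2 t3 η),
        ← ContinuousLinearMap.comp_assoc (adjoint _), adjoint_Mid_Mid,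
        ContinuousLinearMap.smul_comp, ContinuousLinearMap.id_comp] at h'
      have h'' := cspan_smul (⟪η, η⟫_ℂ)⁻¹ h'
      rwa [smul_smul, inv_mul_cancel₀ (inner_self_ne_zero.2 hη), one_smul] at h''
    · rintro _ ⟨ν, a, ha, b, hb, rfl⟩
      rw [← ContinuousLinearMap.comp_assoc (adjoint _), adjoint_Mid_Mid,
        ContinuousLinearMap.smul_comp, ContinuousLinearMap.id_comp]
      exact cspan_smul _ (subset_cspan ⟨a, ha, b, hb, rfl⟩)
  · push Not at hH
    refine subset_cspan ⟨a, ha, b, hb, ?_⟩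
    refine t2.clm_ext (fun x y => ?_)
    rw [hH x]; simp

theorem final_aux (t2 : TensorPair H H H2) (t3 : TensorTriple H H H H3) (W : H2 →L[ℂ] H2)
    (h1 : adjoint W * W = 1) (h2 : W * adjoint W = 1)
    (W12 W23 W13 : H3 →L[ℂ] H3)
    (hW12 : IsLeg12 t2 t3 W W12) (hW23 : IsLeg23 t2 t3 W W23) (hW13 : IsLeg13 t2 t3 W W13)
    (hpent : W23 * W12 = W12 * W13 * W23) (A B : Set (H →L[ℂ] H))
    (a1 : ∀ T ∈ cspan (colSet t2 A), W ∘L T ∈ cspan (colSet t2 A))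
    (a2 : ∀ T ∈ cspan (colSet t2 A), adjoint W ∘L T ∈ cspan (colSet t2 A))
    (b1 : ∀ T ∈ cspan (colSetL t2 B), W ∘L T ∈ cspan (colSetL t2 B))
    (b2 : ∀ T ∈ cspan (colSetL t2 B), adjoint W ∘L T ∈ cspan (colSetL t2 B)) :
    (∀ x ∈ minTensor t2 A B, W ∘L x ∈ minTensor t2 A B) ∧
    (∀ x ∈ minTensor t2 A B, adjoint W ∘L x ∈ minTensor t2 A B) := by
  have e12 := leg12_eq t2 t3 hW12
  have e23 := leg23_eq t2 t3 hW23
  have g12 := mid12 t2 t3 A B W a1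
  have g12s := mid12 t2 t3 A B _ a2
  have g23 := mid23 t2 t3 A B W b1
  have g23s := mid23 t2 t3 A B _ b2
  have i1 : (p12 t2 t3).ampL (p12 t2 t3) (adjoint W) * W12 = 1 := by
    rw [e12]; exact ampL_comp_inv _ h1
  have i2 : W12 * (p12 t2 t3).ampL (p12 t2 t3) (adjoint W) = 1 := by
    rw [e12]; exact ampL_comp_inv _ h2
  have j1 : (p23 t2 t3).ampR (p23 t2 t3) (adjoint W) * W23 = 1 := by
    rw [e23]; exact ampR_comp_inv _ h1
  have j2 : W23 * (p23 t2 t3).ampR (p23 t2 t3) (adjoint W) = 1 := by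
    rw [e23]; exact ampR_comp_inv _ h2
  rw [← e12] at g12
  rw [← e23] at g23
  generalize (p12 t2 t3).ampL (p12 t2 t3) (adjoint W) = V12 at *
  generalize (p23 t2 t3).ampR (p23 t2 t3) (adjoint W) = V23 at *
  have e13 : W13 = V12 * (W23 * (W12 * V23)) := by
    calc W13 = (V12 * W12) * W13 * (W23 * V23) := by rw [i1, j2, one_mul, mul_one]
      _ = V12 * (W12 * W13 * W23) * V23 := by simp only [mul_assoc]
      _ = _ := by rw [← hpent]; simp only [mul_assoc]
  have k1 : (W23 * (V12 * (V23 * W12))) * W13 = 1 := by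
    rw [e13]
    calc _ = W23 * (V12 * (V23 * ((W12 * V12) * (W23 * (W12 * V23))))) := by
            simp only [mul_assoc]
      _ = W23 * (V12 * ((V23 * W23) * (W12 * V23))) := by rw [i2, one_mul]; simp only [mul_assoc]
      _ = W23 * ((V12 * W12) * V23) := by rw [j1, one_mul]; simp only [mul_assoc]
      _ = 1 := by rw [i1, one_mul, j2]
  have m13 := leg13_Mid t2 t3 hW13
  refine ⟨mult_of_mid t2 t3 A B W W13 m13 ?_,
    mult_of_mid t2 t3 A B (adjoint W) (W23 * (V12 * (V23 * W12))) ?_ ?_⟩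
  · intro T hT
    rw [e13]
    exact g12s _ (g23 _ (g12 _ (g23s _ hT)))
  · intro η
    have : Mid t2 t3 η = W13 ∘L (Mid t2 t3 η ∘L adjoint W) := by
      rw [← ContinuousLinearMap.comp_assoc, m13, ContinuousLinearMap.comp_assoc]
      change _ = _ ∘L (W * adjoint W)
      rw [h2]; rfl
    conv_lhs => rw [this]
    rw [← ContinuousLinearMap.comp_assoc]
    change ((W23 * (V12 * (V23 * W12))) * W13) ∘L _ = _
    rw [k1]; rfl
  · intro T hT
    exact g23 _ (g12s _ (g23s _ (g12 _ hT)))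

end final

/-- For a regular multiplicative unitary `W` on `H`, with
`Ŵ := ΣW*Σ` and `D := Â(W) ⊗min Â(Ŵ)`, the unitary `W` is a multiplier of `D`. -/
theorem statement8
    {H H2 H3 : Type*}
    [NormedAddCommGroup H] [InnerProductSpace ℂ H] [CompleteSpace H]
    [NormedAddCommGroup H2] [InnerProductSpace ℂ H2] [CompleteSpace H2]
    [NormedAddCommGroup H3] [InnerProductSpace ℂ H3] [CompleteSpace H3]
    -- realizations of the tensor products H ⊗ H and H ⊗ H ⊗ H
    (t2 : TensorPair H H H2) (t3 : TensorTriple H H H H3)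
    -- W is a unitary on H ⊗ H
    (W : H2 →L[ℂ] H2) (hWu : star W * W = 1 ∧ W * star W = 1)
    -- the legs W₁₂, W₂₃, W₁₃ of W on H ⊗ H ⊗ H
    (W12 W23 W13 : H3 →L[ℂ] H3)
    (hW12 : IsLeg12 t2 t3 W W12) (hW23 : IsLeg23 t2 t3 W W23)
    (hW13 : IsLeg13 t2 t3 W W13)
    -- the pentagon equation W₂₃W₁₂ = W₁₂W₁₃W₂₃
    (hpent : W23 * W12 = W12 * W13 * W23)
    -- the tensor flip Σ on H ⊗ H
    (Sg : H2 →L[ℂ] H2) (hSg : ∀ a b : H, Sg (t2.tmul a b) = t2.tmul b a)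
    -- regularity: C(W) = K(H)
    (hreg : hatA t2 (Sg * W) = {T : H →L[ℂ] H | IsCompactOperator T})
    (D : Set (H2 →L[ℂ] H2))
    (hD : D = minTensor t2 (hatA t2 W) (hatA t2 (Sg * star W * Sg))) :
    ∀ x ∈ D, W * x ∈ D ∧ x * W ∈ D := by
  have h1 : adjoint W * W = 1 := hWu.1
  have h2 : W * adjoint W = 1 := hWu.2
  have hSg2 : Sg * Sg = 1 := t2.clm_ext (fun a b => by simp [hSg])
  have hSga : adjoint Sg = Sg := by
    refine t2.clm_ext (fun a b => t2.vec_ext (fun c d => ?_))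
    rw [adjoint_inner_right, hSg, hSg, t2.inner_tmul, t2.inner_tmul, mul_comm]
  have hSR : ∀ ξ, Sg ∘L t2.R ξ = t2.L ξ := fun ξ => by ext x; simp [hSg]
  have hSL : ∀ ξ, Sg ∘L t2.L ξ = t2.R ξ := fun ξ => by ext x; simp [hSg]
  have hRS : ∀ ξ, adjoint (t2.R ξ) ∘L Sg = adjoint (t2.L ξ) := fun ξ => by
    rw [← hSR, adjoint_comp, hSga]
  have hLS : ∀ ξ, adjoint (t2.L ξ) ∘L Sg = adjoint (t2.R ξ) := fun ξ => by
    rw [← hSL, adjoint_comp, hSga]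
  have hsl : ∀ ξ η, sl t2 (Sg * W) ξ η = adjoint (t2.L ξ) ∘L W ∘L t2.R η := by
    intro ξ η
    rw [← hRS]; rfl
  have hreg' := hreg
  rw [hatA_eq] at hreg'
  simp only [hsl] at hreg'
  have hr1 : ∀ ν β, InnerProductSpace.rankOne ℂ ν β ∈
      cspan {T | ∃ ξ η, T = adjoint (t2.L ξ) ∘L W ∘L t2.R η} := by
    intro ν β
    rw [hreg']
    exact rankOne_compact ν β
  have hr2 : ∀ ξ η, adjoint (t2.L ξ) ∘L W ∘L t2.R η ∈
      cspan {T : H →L[ℂ] H | ∃ ν β, T = InnerProductSpace.rankOne ℂ ν β} := by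
    intro ξ η
    refine compact_mem_cspan _ ?_
    have : adjoint (t2.L ξ) ∘L W ∘L t2.R η ∈ {T : H →L[ℂ] H | IsCompactOperator T} := by
      rw [← hreg']
      exact subset_cspan ⟨ξ, η, rfl⟩
    exact this
  obtain ⟨a1, a2, a3⟩ := core t2 t3 W h1 h2 W12 W23 W13 hW12 hW23 hW13 hpent hr1 hr2
  -- the dual multiplicative unitary
  have hstar : star W = adjoint W := rfl
  rw [hstar] at hD
  have hU : adjoint (Sg * adjoint W * Sg) = Sg * W * Sg := by
    change adjoint ((Sg ∘L adjoint W) ∘L Sg) = _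
    rw [adjoint_comp, adjoint_comp, adjoint_adjoint, hSga]; rfl
  have key : ∀ X Y : H2 →L[ℂ] H2, X * Y = 1 → (Sg * X * Sg) * (Sg * Y * Sg) = 1 := by
    intro X Y h
    calc _ = Sg * (X * ((Sg * Sg) * (Y * Sg))) := by simp only [mul_assoc]
      _ = Sg * ((X * Y) * Sg) := by rw [hSg2, one_mul, mul_assoc]
      _ = 1 := by rw [h, one_mul, hSg2]
  have hSS : ∀ X : H2 →L[ℂ] H2, Sg * (Sg * X * Sg) * Sg = X := by
    intro X
    calc _ = (Sg * Sg) * X * (Sg * Sg) := by simp only [mul_assoc]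
      _ = X := by rw [hSg2, one_mul, mul_one]
  have hdual : ∀ a b a' b' : H, ⟪t2.tmul a b, (Sg * adjoint W * Sg) (t2.tmul a' b')⟫_ℂ
      = (starRingEnd ℂ) ⟪t2.tmul b' a', W (t2.tmul b a)⟫_ℂ := by
    intro a b a' b'
    change ⟪t2.tmul a b, Sg (adjoint W (Sg (t2.tmul a' b')))⟫_ℂ = _
    rw [hSg, ← adjoint_inner_left, hSga, hSg, adjoint_inner_right, inner_conj_symm]
  have hdd : ∀ ξ η, adjoint (t2.L ξ) ∘L (Sg * adjoint W * Sg) ∘L t2.R η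
      = adjoint (adjoint (t2.L η) ∘L W ∘L t2.R ξ) := by
    intro ξ η
    change (adjoint (t2.L ξ) ∘L Sg) ∘L adjoint W ∘L (Sg ∘L t2.R η) = _
    rw [hLS, hSR, adjoint_comp, adjoint_comp, adjoint_adjoint, ContinuousLinearMap.comp_assoc]
  obtain ⟨b1, b2, b3⟩ := core t2 t3.rev (Sg * adjoint W * Sg)
    (by rw [hU]; exact key _ _ h2) (by rw [hU]; exact key _ _ h1)
    (adjoint W23) (adjoint W12) (adjoint W13)
    (by
      intro a a' b b' c c'
      rw [TensorTriple.rev_tmul, TensorTriple.rev_tmul, adjoint_inner_right, ← inner_conj_symm,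
        hW23, map_mul, inner_conj_symm c, hdual])
    (by
      intro a a' b b' c c'
      rw [TensorTriple.rev_tmul, TensorTriple.rev_tmul, adjoint_inner_right, ← inner_conj_symm,
        hW12, map_mul, inner_conj_symm a, hdual])
    (by
      intro a a' b b' c c'
      rw [TensorTriple.rev_tmul, TensorTriple.rev_tmul, adjoint_inner_right, ← inner_conj_symm,
        hW13, map_mul, inner_conj_symm b, hdual])
    (by
      have := congrArg star hpent
      rw [star_mul, star_mul, star_mul] at this
      exact this.trans (mul_assoc _ _ _).symm)
    (by
      intro ν β
      have := cspan_map (adjC H H)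
        (S' := {T | ∃ ξ η, T = adjoint (t2.L ξ) ∘L (Sg * adjoint W * Sg) ∘L t2.R η}) ?_ _ (hr1 β ν)
      · have e : adjC H H (InnerProductSpace.rankOne ℂ β ν) = InnerProductSpace.rankOne ℂ ν β :=
          InnerProductSpace.adjoint_rankOne _ _
        rwa [e] at this
      · rintro _ ⟨ξ, η, rfl⟩
        exact subset_cspan ⟨η, ξ, (hdd η ξ).symm⟩)
    (by
      intro ξ η
      rw [hdd]
      refine cspan_map (adjC H H) ?_ _ (hr2 η ξ)
      rintro _ ⟨ν, β, rfl⟩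
      exact subset_cspan ⟨β, ν, InnerProductSpace.adjoint_rankOne _ _⟩)
  have c2 := colL_of_col t2 _ Sg hSg _ b1
  have c1 := colL_of_col t2 _ Sg hSg _ b2
  rw [← b3] at c1 c2
  rw [hU, hSS] at c1
  rw [hSS] at c2
  rw [← a3] at a1 a2
  obtain ⟨f1, f2⟩ := final_aux t2 t3 W h1 h2 W12 W23 W13 hW12 hW23 hW13 hpent _ _ a1 a2 c1 c2
  have fs := minTensor_adjoint t2 (hatA t2 W) (hatA t2 (Sg * adjoint W * Sg))
    (fun a ha => by rw [a3]; exact hatA_adjoint t2 _ _ ha)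
    (fun b hb => by rw [b3]; exact hatA_adjoint t2 _ _ hb)
  subst hD
  intro x hx
  refine ⟨f1 x hx, ?_⟩
  have h := fs _ (f2 _ (fs _ hx))
  rw [adjoint_comp, adjoint_adjoint, adjoint_adjoint] at h
  exact h

end
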